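/- arXiv:1312.2210 — 6 statements merged into one kernel-verified Lean document; each statement's English description precedes it below -/
import Mathlib

section
/- Let Γ ⊆ Iso(ℝⁿ_s) be a subgroup having the Wolf properties, and let D ⊆ ℝⁿ be an open orbit of the centraliser C of Γ in Iso(ℝⁿ_s). If the linear holonomy group Hol(Γ) is abelian, then D is translationally isotropic, i.e. T(D)^⊥ ⊆ T(D). -/
noncomputable section

/-- `ℝⁿ` as a coordinate space. -/
abbrev E (n : ℕ) : Type := Fin n → ℝ

/-- The standard symmetric bilinear form of signature `(n-s, s)` on `ℝⁿ`. -/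
def B (n s : ℕ) : LinearMap.BilinForm ℝ (E n) :=
  LinearMap.mk₂ ℝ
    (fun x y => ∑ i : Fin n, (if (i : ℕ) < n - s then x i * y i else -(x i * y i)))
    (by
      intro x x' y
      rw [← Finset.sum_add_distrib]
      refine Finset.sum_congr rfl fun i _ => ?_
      by_cases h : (i : ℕ) < n - s <;> simp [h] <;> ring)
    (by
      intro c x y
      rw [Finset.smul_sum]
      refine Finset.sum_congr rfl fun i _ => ?_
      by_cases h : (i : ℕ) < n - s <;> simp [h] <;> ring)
    (by
      intro x y y'
      rw [← Finset.sum_add_distrib]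
      refine Finset.sum_congr rfl fun i _ => ?_
      by_cases h : (i : ℕ) < n - s <;> simp [h] <;> ring)
    (by
      intro c x y
      rw [Finset.smul_sum]
      refine Finset.sum_congr rfl fun i _ => ?_
      by_cases h : (i : ℕ) < n - s <;> simp [h] <;> ring)

/-- Orthogonal complement (w.r.t. the form `B n s`) of a set `S ⊆ ℝⁿ`. -/
def perp (n s : ℕ) (S : Set (E n)) : Set (E n) :=
  {x | ∀ w ∈ S, B n s x w = 0}

/-- A set of vectors is totally isotropic if the form vanishes identically on it. -/
def TotallyIsotropicSet (n s : ℕ) (U : Set (E n)) : Prop :=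
  ∀ u ∈ U, ∀ u' ∈ U, B n s u u' = 0

/-- The set `T(D)` of translations preserving `D`. -/
def TransSet (n : ℕ) (D : Set (E n)) : Set (E n) :=
  {v | ∀ x ∈ D, v + x ∈ D}

/-- `D` is translationally isotropic if `T(D)^⊥ ⊆ T(D)`. -/
def TranslationallyIsotropic (n s : ℕ) (D : Set (E n)) : Prop :=
  perp n s (TransSet n D) ⊆ TransSet n D

/-- The group of invertible affine transformations of `ℝⁿ`. -/
abbrev Aff (n : ℕ) : Type := (E n) ≃ᵃ[ℝ] (E n)

/-- The affine isometries of `ℝⁿ_s`: affine transformations whose linear part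
preserves the bilinear form. -/
def Iso (n s : ℕ) : Set (Aff n) :=
  {g | ∀ x y : E n, B n s (g.linear x) (g.linear y) = B n s x y}

/-- For `γ = (I + A, v)`, the matrix `A`, i.e. the linear part minus the identity. -/
def linA (n : ℕ) (γ : Aff n) : (E n) →ₗ[ℝ] (E n) :=
  γ.linear.toLinearMap - LinearMap.id

/-- The translation part `v` of an affine transformation. -/
def transPart (n : ℕ) (γ : Aff n) : E n := γ 0

/-- The Wolf properties of a single affine isometry `γ = (I + A, v)`:
`A² = 0`, `Av = 0`, `im A` totally isotropic, `v ⊥ im A`,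
`im A = (ker A)^⊥` and `ker A = (im A)^⊥`. -/
def WolfElt (n s : ℕ) (γ : Aff n) : Prop :=
  linA n γ ∘ₗ linA n γ = 0 ∧
  linA n γ (transPart n γ) = 0 ∧
  TotallyIsotropicSet n s (LinearMap.range (linA n γ) : Set (E n)) ∧
  transPart n γ ∈ perp n s (LinearMap.range (linA n γ) : Set (E n)) ∧
  (LinearMap.range (linA n γ) : Set (E n)) = perp n s (LinearMap.ker (linA n γ) : Set (E n)) ∧
  (LinearMap.ker (linA n γ) : Set (E n)) = perp n s (LinearMap.range (linA n γ) : Set (E n))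

/-- The linear holonomy group `Hol(Γ)` (the group of linear parts) is abelian. -/
def HolAbelian (n : ℕ) (Γ : Subgroup (Aff n)) : Prop :=
  ∀ γ₁ ∈ Γ, ∀ γ₂ ∈ Γ,
    γ₁.linear.toLinearMap ∘ₗ γ₂.linear.toLinearMap =
      γ₂.linear.toLinearMap ∘ₗ γ₁.linear.toLinearMap

/-- The centraliser of `Γ` in `Iso(ℝⁿ_s)`. -/
def CentrIso (n s : ℕ) (Γ : Subgroup (Aff n)) : Set (Aff n) :=
  {g ∈ Iso n s | ∀ γ ∈ Γ, g * γ = γ * g}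

/-- The subspace `U_Γ = ∑_{(I+A,v) ∈ Γ} im A`. -/
def UGamma (n : ℕ) (Γ : Subgroup (Aff n)) : Submodule ℝ (E n) :=
  ⨆ γ ∈ Γ, LinearMap.range (linA n γ)

/-- The set `U₀ = U_Γ ∩ U_Γ^⊥`. -/
def U0 (n s : ℕ) (Γ : Subgroup (Aff n)) : Set (E n) :=
  (UGamma n Γ : Set (E n)) ∩ perp n s (UGamma n Γ : Set (E n))

/-- The translation `τ_u : x ↦ u + x` as an affine transformation. -/
def τ (n : ℕ) (u : E n) : Aff n := AffineEquiv.constVAdd ℝ (E n) u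


theorem prod_zero_of_sq {R : Type*} [Ring R] (a b : R) (ha : a * a = 0) (hb : b * b = 0)
    (hab : a * b = b * a) (h : (a + b + a * b) * (a + b + a * b) = 0) :
    a * b + a * b = 0 := by
  have e1 : a * (a * b) = 0 := by rw [← mul_assoc, ha, zero_mul]
  have e2 : b * (a * b) = 0 := by rw [hab, ← mul_assoc, hb, zero_mul]
  have e3 : a * b * a = 0 := by rw [mul_assoc, ← hab, e1]
  have e4 : a * b * b = 0 := by rw [mul_assoc, hb, mul_zero]
  have e5 : a * b * (a * b) = 0 := by rw [mul_assoc, e2, mul_zero]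
  simp only [add_mul, mul_add, ha, hb, e1, e2, e3, e4, e5, ← hab] at h
  simpa using h

theorem linA_linear_apply (n : ℕ) (γ : Aff n) (x : E n) :
    γ.linear x = linA n γ x + x := by
  simp [linA]

/-- Abelian holonomy and the Wolf properties give `A₁ A₂ = 0`. -/
theorem linA_comp_zero (n s : ℕ) (Γ : Subgroup (Aff n))
    (hWolf : ∀ γ ∈ Γ, WolfElt n s γ) (habel : HolAbelian n Γ)
    (γ₁ : Aff n) (h₁ : γ₁ ∈ Γ) (γ₂ : Aff n) (h₂ : γ₂ ∈ Γ) (x : E n) :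
    linA n γ₁ (linA n γ₂ x) = 0 := by
  have ha : (linA n γ₁ : Module.End ℝ (E n)) * linA n γ₁ = 0 := (hWolf γ₁ h₁).1
  have hb : (linA n γ₂ : Module.End ℝ (E n)) * linA n γ₂ = 0 := (hWolf γ₂ h₂).1
  have hc : (linA n (γ₁ * γ₂) : Module.End ℝ (E n)) * linA n (γ₁ * γ₂) = 0 :=
    (hWolf _ (Γ.mul_mem h₁ h₂)).1
  have hab : (linA n γ₁ : Module.End ℝ (E n)) * linA n γ₂ = linA n γ₂ * linA n γ₁ := by
    apply LinearMap.ext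
    intro y
    have := LinearMap.congr_fun (habel γ₁ h₁ γ₂ h₂) y
    simp only [LinearMap.comp_apply, LinearEquiv.coe_coe, linA_linear_apply, map_add] at this
    simp only [Module.End.mul_apply]
    have h' : linA n γ₁ (linA n γ₂ y) + (linA n γ₁ y + linA n γ₂ y + y)
        = linA n γ₂ (linA n γ₁ y) + (linA n γ₁ y + linA n γ₂ y + y) := by
      convert this using 1 <;> abel
    exact add_right_cancel h'
  have hm : (linA n (γ₁ * γ₂) : Module.End ℝ (E n))
      = linA n γ₁ + linA n γ₂ + (linA n γ₁ : Module.End ℝ (E n)) * linA n γ₂ := by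
    apply LinearMap.ext
    intro y
    have e : (γ₁ * γ₂).linear y = γ₁.linear (γ₂.linear y) := rfl
    simp only [linA_linear_apply, map_add] at e
    simp only [Module.End.mul_apply, LinearMap.add_apply]
    refine add_right_cancel (b := y) ?_
    rw [e]
    abel
  rw [hm] at hc
  have := LinearMap.congr_fun (prod_zero_of_sq _ _ ha hb hab hc) x
  simp only [LinearMap.add_apply, Module.End.mul_apply, LinearMap.zero_apply] at this
  exact self_eq_neg.mp (eq_neg_of_add_eq_zero_left this)

/-- Vectors killed by all `A` give translations of the orbit. -/
theorem mem_transSet_of_ker (n s : ℕ) (Γ : Subgroup (Aff n)) (p u : E n)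
    (hu : ∀ γ ∈ Γ, linA n γ u = 0) :
    u ∈ TransSet n ((fun g => g p) '' CentrIso n s Γ) := by
  rintro _ ⟨g, ⟨hgI, hgC⟩, rfl⟩
  refine ⟨τ n u * g, ⟨?_, ?_⟩, rfl⟩
  · intro x y
    exact hgI x y
  · intro γ hγ
    apply AffineEquiv.ext
    intro x
    have h1 : g (γ x) = γ (g x) := congrArg (fun f : Aff n => f x) (hgC γ hγ)
    have h2 : γ (u +ᵥ g x) = γ.linear u +ᵥ γ (g x) := γ.map_vadd _ _
    change u +ᵥ g (γ x) = γ (u +ᵥ g x)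
    rw [h1, h2, linA_linear_apply, hu γ hγ, zero_add]

/-- If `Γ ⊆ Iso(ℝⁿ_s)` is a subgroup with the Wolf properties and
`D` is an open orbit of the centraliser of `Γ` in `Iso(ℝⁿ_s)`, then abelian linear
holonomy implies that `D` is translationally isotropic. -/
theorem flat_homogeneous_abelian_holonomy_translationally_isotropic
    (n s : ℕ) (hn : 1 ≤ n) (hs : s ≤ n)
    (Γ : Subgroup (Aff n)) (hΓIso : (Γ : Set (Aff n)) ⊆ Iso n s)
    (hWolf : ∀ γ ∈ Γ, WolfElt n s γ)
    (D : Set (E n)) (p : E n)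
    (hD : D = (fun g => g p) '' CentrIso n s Γ)
    (hDopen : IsOpen D)
    (habel : HolAbelian n Γ) :
    TranslationallyIsotropic n s D := by
  subst hD
  intro x hx
  apply mem_transSet_of_ker
  intro γ hγ
  have hk := (hWolf γ hγ).2.2.2.2.2
  have : x ∈ (LinearMap.ker (linA n γ) : Set (E n)) := by
    rw [hk]
    rintro _ ⟨y, rfl⟩
    apply hx
    apply mem_transSet_of_ker
    intro γ' hγ'
    exact linA_comp_zero n s Γ hWolf habel γ' hγ' γ hγ y
  exact this

end
end

section
/- Let Γ ⊆ Iso(ℝⁿ_s) be a subgroup having the Wolf properties whose centraliser C in Iso(ℝⁿ_s) has an open orbit D ⊆ ℝⁿ. If the linear holonomy group Hol(Γ) is not abelian, then s ≥ 4. -/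
noncomputable section

theorem B_app (n s : ℕ) (x y : E n) : B n s x y =
    ∑ i : Fin n, (if (i : ℕ) < n - s then x i * y i else -(x i * y i)) := rfl

theorem B_symm' (n s : ℕ) (x y : E n) : B n s x y = B n s y x := by
  simp only [B_app, mul_comm]

theorem B_nondeg (n s : ℕ) (w : E n) (hw : w ≠ 0) : ∃ y, B n s w y ≠ 0 := by
  obtain ⟨i, hi⟩ := Function.ne_iff.mp hw
  refine ⟨Pi.single i 1, ?_⟩
  rw [B_app, Finset.sum_eq_single i]
  · by_cases h : (i : ℕ) < n - s <;> simpa [h] using hi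
  · intro j _ hj
    simp [hj]
  · simp

theorem isotropic_zero (n s : ℕ) (u : E n) (hu : B n s u u = 0)
    (h : ∀ i : Fin n, ¬ (i : ℕ) < n - s → u i = 0) : u = 0 := by
  rw [B_app] at hu
  have hnn : ∀ i ∈ Finset.univ,
      0 ≤ (if ((i : Fin n) : ℕ) < n - s then u i * u i else -(u i * u i)) := by
    intro i _
    by_cases hi : (i : ℕ) < n - s
    · simp only [hi, if_true]; exact mul_self_nonneg _
    · simp [hi, h i hi]
  rw [Finset.sum_eq_zero_iff_of_nonneg hnn] at hu
  funext i
  by_cases hi : (i : ℕ) < n - s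
  · have := hu i (Finset.mem_univ _)
    simpa [hi] using this
  · exact h i hi

theorem four_le (n s : ℕ) (hs : s ≤ n) (F : (Fin 4 → ℝ) →ₗ[ℝ] E n)
    (hF : Function.Injective F) (hiso : ∀ c, B n s (F c) (F c) = 0) : 4 ≤ s := by
  let G : (Fin 4 → ℝ) →ₗ[ℝ] (Fin s → ℝ) :=
    (LinearMap.funLeft ℝ ℝ (fun j : Fin s => (⟨n - s + j, by omega⟩ : Fin n))) ∘ₗ F
  have hG : Function.Injective G := by
    rw [← LinearMap.ker_eq_bot, LinearMap.ker_eq_bot']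
    intro c hc
    apply hF
    rw [map_zero]
    refine isotropic_zero n s _ (hiso c) ?_
    intro i hi
    have := congrFun hc ⟨(i : ℕ) - (n - s), by omega⟩
    simp only [G, LinearMap.comp_apply, LinearMap.funLeft_apply, Pi.zero_apply] at this
    convert this using 2
    apply Fin.ext
    simp only
    omega
  have := LinearMap.finrank_le_finrank_of_injective hG
  simpa using this

theorem aff_decomp (n : ℕ) (γ : Aff n) (x : E n) :
    γ x = x + (linA n γ x + transPart n γ) := by
  have h := γ.map_vadd (0 : E n) x
  simp only [vadd_eq_add, add_zero] at h
  rw [h]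
  simp only [linA, transPart, LinearMap.sub_apply, LinearMap.id_apply,
    LinearEquiv.coe_coe]
  abel

theorem disp_const (n s : ℕ) (Γ : Subgroup (Aff n)) (p : E n) (γ₁ γ₂ : Aff n)
    (h1 : γ₁ ∈ Γ) (h2 : γ₂ ∈ Γ) (g : Aff n) (hg : g ∈ CentrIso n s Γ) :
    B n s (linA n γ₁ (g p) + transPart n γ₁) (linA n γ₂ (g p) + transPart n γ₂) =
    B n s (linA n γ₁ p + transPart n γ₁) (linA n γ₂ p + transPart n γ₂) := by
  have key : ∀ γ ∈ Γ, linA n γ (g p) + transPart n γ =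
      g.linear (linA n γ p + transPart n γ) := by
    intro γ hγ
    have h := congrArg (fun f : Aff n => f p) (hg.2 γ hγ)
    simp only [AffineEquiv.mul_def, AffineEquiv.trans_apply] at h
    rw [aff_decomp n γ (g p), aff_decomp n γ p, add_comm p] at h
    have h' := g.map_vadd p (linA n γ p + transPart n γ)
    simp only [vadd_eq_add] at h'
    rw [h', add_comm] at h
    exact (add_left_cancel h).symm
  rw [key γ₁ h1, key γ₂ h2, hg.1]

theorem cross_zero (n s : ℕ) (A₁ A₂ : E n →ₗ[ℝ] E n) (v₁ v₂ p : E n) (D : Set (E n))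
    (hD : IsOpen D) (hp : p ∈ D)
    (h : ∀ q ∈ D, B n s (A₁ q + v₁) (A₂ q + v₂) = B n s (A₁ p + v₁) (A₂ p + v₂))
    (x : E n) : B n s (A₁ x) (A₂ x) = 0 := by
  obtain ⟨t, ht, h1, h2⟩ : ∃ t : ℝ, 0 < t ∧ p + t • x ∈ D ∧ p + (-t) • x ∈ D := by
    have hc : Continuous (fun t : ℝ => p + t • x) := by fun_prop
    have ho := hD.preimage hc
    obtain ⟨ε, hε, hb⟩ := Metric.isOpen_iff.mp ho 0 (by simpa using hp)
    refine ⟨ε / 2, by positivity, hb ?_, hb ?_⟩ <;>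
      simp [abs_of_pos hε] <;> linarith
  have e1 := h _ h1
  have e2 := h _ h2
  simp only [map_add, map_smul, LinearMap.add_apply, LinearMap.smul_apply, smul_eq_mul] at e1 e2
  have : t ^ 2 * B n s (A₁ x) (A₂ x) = 0 := by linear_combination (e1 + e2) / 2
  simpa [ht.ne'] using this

theorem skew_of_wolf (n s : ℕ) (γ : Aff n) (hi : γ ∈ Iso n s) (hw : WolfElt n s γ)
    (x y : E n) : B n s (linA n γ x) y = - B n s x (linA n γ y) := by
  have h := hi x y
  have hx : γ.linear x = x + linA n γ x := by simp [linA]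
  have hy : γ.linear y = y + linA n γ y := by simp [linA]
  have h0 := hw.2.2.1 (linA n γ x) ⟨x, rfl⟩ (linA n γ y) ⟨y, rfl⟩
  rw [hx, hy] at h
  simp only [map_add, LinearMap.add_apply] at h
  linarith

/-- If `Γ ⊆ Iso(ℝⁿ_s)` is a subgroup with the Wolf properties whose
centraliser in `Iso(ℝⁿ_s)` has an open orbit `D`, and the linear holonomy group
`Hol(Γ)` is not abelian, then `s ≥ 4`. -/
theorem nonabelian_holonomy_index_ge_four
    (n s : ℕ) (hn : 1 ≤ n) (hs : s ≤ n)
    (Γ : Subgroup (Aff n)) (hΓIso : (Γ : Set (Aff n)) ⊆ Iso n s)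
    (hWolf : ∀ γ ∈ Γ, WolfElt n s γ)
    (D : Set (E n)) (p : E n)
    (hD : D = (fun g => g p) '' CentrIso n s Γ)
    (hDopen : IsOpen D)
    (hnonabel : ¬ HolAbelian n Γ) :
    4 ≤ s := by
  obtain ⟨γ₁, h1, γ₂, h2, hne⟩ : ∃ γ₁ ∈ Γ, ∃ γ₂ ∈ Γ,
      γ₁.linear.toLinearMap ∘ₗ γ₂.linear.toLinearMap ≠
      γ₂.linear.toLinearMap ∘ₗ γ₁.linear.toLinearMap := by
    simpa [HolAbelian] using hnonabel
  have hp : p ∈ D := by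
    rw [hD]
    refine ⟨1, ⟨fun x y => rfl, fun γ _ => by simp⟩, rfl⟩
  have hcross : ∀ x, B n s (linA n γ₁ x) (linA n γ₂ x) = 0 := by
    refine cross_zero n s _ _ (transPart n γ₁) (transPart n γ₂) p D hDopen hp ?_
    intro q hq
    rw [hD] at hq
    obtain ⟨g, hg, rfl⟩ := hq
    exact disp_const n s Γ p γ₁ γ₂ h1 h2 g hg
  have sk1 := skew_of_wolf n s γ₁ (hΓIso h1) (hWolf _ h1)
  have sk2 := skew_of_wolf n s γ₂ (hΓIso h2) (hWolf _ h2)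
  have iso1 : ∀ z, B n s (linA n γ₁ z) (linA n γ₁ z) = 0 :=
    fun z => (hWolf _ h1).2.2.1 _ ⟨z, rfl⟩ _ ⟨z, rfl⟩
  have sq2 : ∀ z, linA n γ₂ (linA n γ₂ z) = 0 :=
    fun z => LinearMap.congr_fun (hWolf _ h2).1 z
  have hne' : ∃ x, linA n γ₁ (linA n γ₂ x) - linA n γ₂ (linA n γ₁ x) ≠ 0 := by
    by_contra! hcon
    apply hne
    refine LinearMap.ext fun x => ?_
    have := hcon x
    simp only [linA, LinearMap.sub_apply, LinearMap.id_apply, map_sub] at this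
    simp only [LinearMap.comp_apply]
    rw [← sub_eq_zero, ← this]
    abel
  generalize linA n γ₁ = A₁ at *
  generalize linA n γ₂ = A₂ at *
  have pol : ∀ x y, B n s (A₁ x) (A₂ y) = - B n s (A₁ y) (A₂ x) := by
    intro x y
    have h := hcross (x + y)
    simp only [map_add, LinearMap.add_apply, hcross] at h
    linarith
  obtain ⟨x, hx⟩ := hne'
  obtain ⟨y, hy⟩ := B_nondeg n s _ hx
  have hk : B n s (A₁ y) (A₂ x) ≠ 0 := by
    intro hk
    apply hy
    have h3 := pol x y
    rw [map_sub, LinearMap.sub_apply, sk1 (A₂ x) y, sk2 (A₁ x) y, h3, B_symm' n s (A₂ x), hk]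
    simp
  refine four_le n s hs (A₁ ∘ₗ Fintype.linearCombination ℝ ![x, y, A₂ x, A₂ y]) ?_
    (fun c => iso1 _)
  rw [← LinearMap.ker_eq_bot, LinearMap.ker_eq_bot']
  intro c hc
  simp only [LinearMap.comp_apply, Fintype.linearCombination_apply, Fin.sum_univ_four,
    map_add, map_smul] at hc
  simp only [Matrix.cons_val] at hc
  have hz : ∀ a b, B n s (A₁ (A₂ a)) (A₂ b) = 0 := by
    intro a b
    rw [pol, sq2]; simp
  have ex := congrArg (fun w => B n s w (A₂ x)) hc
  have ey := congrArg (fun w => B n s w (A₂ y)) hc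
  have fx := congrArg (fun w => B n s w x) hc
  have fy := congrArg (fun w => B n s w y) hc
  simp only [map_add, map_smul, LinearMap.add_apply, LinearMap.smul_apply, smul_eq_mul, hz,
    hcross, map_zero, LinearMap.zero_apply] at ex ey fx fy
  have c1 : c 1 = 0 := by simpa [hk] using ex
  have c0 : c 0 = 0 := by
    rw [pol x y] at ey
    simpa [hk] using ey
  have d1 : ∀ a b, B n s (A₁ (A₂ a)) b = - B n s (A₁ b) (A₂ a) := by
    intro a b
    rw [sk1, B_symm']
  rw [d1, d1, hcross, c0, c1, pol x y] at fx
  rw [d1, d1, hcross, c0, c1] at fy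
  have c2 : c 2 = 0 := by simpa [hk] using fy
  have c3 : c 3 = 0 := by simpa [hk] using fx
  funext i
  fin_cases i <;> simp [c0, c1, c2, c3]


end
end

section
/- Let Γ ⊆ Iso(ℝⁿ_s) be a subgroup having the Wolf properties. Then the following are equivalent: (1) Hol(Γ) is abelian; (2) for all (I+A₁, v₁), (I+A₂, v₂) ∈ Γ one has A₁A₂ = 0; (3) U_Γ is totally isotropic; (4) U₀ = U_Γ. -/
noncomputable section

/-- **Wolf.** For a subgroup `Γ ⊆ Iso(ℝⁿ_s)` with the Wolf properties,
the following are equivalent: (1) `Hol(Γ)` is abelian; (2) `A₁A₂ = 0` for all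
`(I+A₁,v₁), (I+A₂,v₂) ∈ Γ`; (3) `U_Γ` is totally isotropic; (4) `U₀ = U_Γ`. -/
theorem holonomy_abelian_tfae
    (n s : ℕ) (hn : 1 ≤ n) (hs : s ≤ n)
    (Γ : Subgroup (Aff n)) (hΓIso : (Γ : Set (Aff n)) ⊆ Iso n s)
    (hWolf : ∀ γ ∈ Γ, WolfElt n s γ) :
    [ HolAbelian n Γ,
      ∀ γ₁ ∈ Γ, ∀ γ₂ ∈ Γ, linA n γ₁ ∘ₗ linA n γ₂ = 0,
      TotallyIsotropicSet n s (UGamma n Γ : Set (E n)),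
      U0 n s Γ = (UGamma n Γ : Set (E n)) ].TFAE := by
  tfae_have 1 → 2 := by
    intro h g₁ h₁ g₂ h₂
    have e := (hWolf _ (Γ.mul_mem h₁ h₂)).1
    have e₁ := (hWolf _ h₁).1
    have e₂ := (hWolf _ h₂).1
    have c := h g₁ h₁ g₂ h₂
    have hm : linA n (g₁ * g₂) =
        g₁.linear.toLinearMap ∘ₗ g₂.linear.toLinearMap - LinearMap.id := rfl
    rw [hm] at e
    have d₁ : g₁.linear.toLinearMap = linA n g₁ + LinearMap.id := by simp [linA]
    have d₂ : g₂.linear.toLinearMap = linA n g₂ + LinearMap.id := by simp [linA]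
    rw [d₁, d₂] at c e
    generalize linA n g₁ = a at *
    generalize linA n g₂ = b at *
    change (a : Module.End ℝ (E n)) * b = 0
    change ((a : Module.End ℝ (E n)) + 1) * (b + 1) = (b + 1) * (a + 1) at c
    change (((a : Module.End ℝ (E n)) + 1) * (b + 1) - 1) * ((a + 1) * (b + 1) - 1) = 0 at e
    change (a : Module.End ℝ (E n)) * a = 0 at e₁
    change (b : Module.End ℝ (E n)) * b = 0 at e₂
    have c' : (b : Module.End ℝ (E n)) * a = a * b := by
      have : (a * b - b * a : Module.End ℝ (E n)) = 0 := by
        have := sub_eq_zero.mpr c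
        rw [← this]; noncomm_ring
      exact (sub_eq_zero.mp this).symm
    have aba : (a * b * a : Module.End ℝ (E n)) = 0 := by
      rw [mul_assoc, c', ← mul_assoc, e₁, zero_mul]
    have bab : (b * a * b : Module.End ℝ (E n)) = 0 := by
      rw [c', mul_assoc, e₂, mul_zero]
    have key : (((a : Module.End ℝ (E n)) + 1) * (b + 1) - 1) * ((a + 1) * (b + 1) - 1)
        = a * a + b * b + a * b + b * a + a * a * b + b * a * b + a * b * a + a * (b * b)
          + a * b * a * b := by
      have f : ((a : Module.End ℝ (E n)) + 1) * (b + 1) - 1 = a * b + a + b := by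
        rw [add_mul, mul_add, mul_one, one_mul]; abel
      rw [f]; noncomm_ring
    rw [key, e₁, e₂, aba, bab, c'] at e
    simp only [zero_mul, mul_zero, add_zero, zero_add] at e
    rw [← two_smul ℝ] at e
    exact (smul_eq_zero.mp e).resolve_left two_ne_zero
  tfae_have 2 → 1 := by
    intro h g₁ h₁ g₂ h₂
    have c₁ := h g₁ h₁ g₂ h₂
    have c₂ := h g₂ h₂ g₁ h₁
    have d₁ : g₁.linear.toLinearMap = linA n g₁ + LinearMap.id := by simp [linA]
    have d₂ : g₂.linear.toLinearMap = linA n g₂ + LinearMap.id := by simp [linA]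
    rw [d₁, d₂]
    simp only [LinearMap.add_comp, LinearMap.comp_add, c₁, c₂, LinearMap.comp_id,
      LinearMap.id_comp]
    abel
  tfae_have 2 → 3 := by
    intro h
    have step : ∀ g₁ ∈ Γ, ∀ g₂ ∈ Γ, ∀ x y, B n s (linA n g₂ x) (linA n g₁ y) = 0 := by
      intro g₁ h₁ g₂ h₂ x y
      have hk : linA n g₂ x ∈ (LinearMap.ker (linA n g₁) : Set (E n)) :=
        LinearMap.congr_fun (h g₁ h₁ g₂ h₂) x
      rw [(hWolf g₁ h₁).2.2.2.2.2] at hk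
      exact hk _ ⟨y, rfl⟩
    have s1 : ∀ g₂ ∈ Γ, ∀ x, UGamma n Γ ≤ LinearMap.ker (B n s (linA n g₂ x)) := by
      intro g₂ h₂ x
      refine iSup₂_le fun g₁ h₁ => ?_
      rintro _ ⟨y, rfl⟩
      exact step g₁ h₁ g₂ h₂ x y
    intro u hu u' hu'
    have s2 : UGamma n Γ ≤ LinearMap.ker ((B n s).flip u') := by
      refine iSup₂_le fun g₂ h₂ => ?_
      rintro _ ⟨x, rfl⟩
      exact s1 g₂ h₂ x hu'
    exact s2 hu
  tfae_have 3 → 2 := by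
    intro h g₁ h₁ g₂ h₂
    have hle : ∀ g ∈ Γ, LinearMap.range (linA n g) ≤ UGamma n Γ := fun g hg =>
      le_iSup₂ (f := fun g (_ : g ∈ Γ) => LinearMap.range (linA n g)) g hg
    refine LinearMap.ext fun x => ?_
    have hk : linA n g₂ x ∈ (LinearMap.ker (linA n g₁) : Set (E n)) := by
      rw [(hWolf g₁ h₁).2.2.2.2.2]
      intro w hw
      exact h _ (hle g₂ h₂ ⟨x, rfl⟩) _ (hle g₁ h₁ hw)
    exact hk
  tfae_have 3 → 4 := fun h => Set.inter_eq_left.mpr fun u hu w hw => h u hu w hw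
  tfae_have 4 → 3 := fun h u hu w hw => Set.inter_eq_left.mp h hu w hw
  tfae_finish

end
end

section
/- Let Γ ⊆ Iso(ℝⁿ_s) be a subgroup having the Wolf properties. Then for every u ∈ U₀ the translation τ_u : x ↦ x + u commutes with every element of Γ (so τ_u lies in the centraliser C of Γ in Iso(ℝⁿ_s)); consequently, if D ⊆ ℝⁿ is an orbit of C, then u + D ⊆ D for all u ∈ U₀, i.e. U₀ ⊆ C ∩ T(D). -/
noncomputable section

/-- If `Γ ⊆ Iso(ℝⁿ_s)` is a subgroup with the Wolf properties, then
every translation `τ_u` by a vector `u ∈ U₀` commutes with every element of `Γ`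
(hence lies in the centraliser `C` of `Γ` in `Iso(ℝⁿ_s)`); consequently, if `D` is an
orbit of `C`, then `U₀ ⊆ C ∩ T(D)`. -/
theorem U0_translations_in_centraliser
    (n s : ℕ) (hn : 1 ≤ n) (hs : s ≤ n)
    (Γ : Subgroup (Aff n)) (hΓIso : (Γ : Set (Aff n)) ⊆ Iso n s)
    (hWolf : ∀ γ ∈ Γ, WolfElt n s γ) :
    (∀ u ∈ U0 n s Γ, ∀ γ ∈ Γ, τ n u * γ = γ * τ n u) ∧
    (∀ D : Set (E n), ∀ p : E n, D = (fun g => g p) '' CentrIso n s Γ →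
      ∀ u ∈ U0 n s Γ, τ n u ∈ CentrIso n s Γ ∧ u ∈ TransSet n D) := by
  have hfix : ∀ u ∈ U0 n s Γ, ∀ γ ∈ Γ, γ.linear u = u := by
    intro u hu γ hγ
    have hk : u ∈ (LinearMap.ker (linA n γ) : Set (E n)) := by
      rw [(hWolf γ hγ).2.2.2.2.2]
      intro w hw
      exact hu.2 w ((le_iSup₂_of_le (f := fun γ (_ : γ ∈ Γ) => LinearMap.range (linA n γ))
        γ hγ le_rfl : _ ≤ UGamma n Γ) hw)
    have h0 : γ.linear u - u = 0 := hk
    exact sub_eq_zero.mp h0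
  have hcomm : ∀ u ∈ U0 n s Γ, ∀ γ ∈ Γ, τ n u * γ = γ * τ n u := by
    intro u hu γ hγ
    ext1 x
    have h1 : γ (u +ᵥ x) = γ.linear u +ᵥ γ x := γ.map_vadd x u
    rw [hfix u hu γ hγ] at h1
    exact h1.symm
  have hC : ∀ u ∈ U0 n s Γ, τ n u ∈ CentrIso n s Γ :=
    fun u hu => ⟨fun x y => rfl, hcomm u hu⟩
  refine ⟨hcomm, ?_⟩
  rintro D p rfl u hu
  refine ⟨hC u hu, ?_⟩
  rintro _ ⟨g, hg, rfl⟩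
  refine ⟨τ n u * g, ⟨fun x y => hg.1 x y, fun γ hγ => ?_⟩, rfl⟩
  rw [mul_assoc, hg.2 γ hγ, ← mul_assoc, hcomm u hu γ hγ, mul_assoc]

end
end

section
/- Let Γ ⊆ Iso(ℝⁿ_s) be a subgroup having the Wolf properties. Then Hol(Γ) is abelian if and only if for every u ∈ U₀^⊥ the translation τ_u : x ↦ x + u commutes with every element of Γ (i.e. all translations by vectors of U₀^⊥ lie in the centraliser C of Γ in Iso(ℝⁿ_s)). -/
noncomputable section

theorem mem_UGamma (n : ℕ) (Γ : Subgroup (Aff n)) (γ : Aff n) (h : γ ∈ Γ) (y : E n) :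
    linA n γ y ∈ UGamma n Γ :=
  (le_iSup₂_of_le (f := fun (γ : Aff n) (_ : γ ∈ Γ) => LinearMap.range (linA n γ)) γ h le_rfl)
    (LinearMap.mem_range_self _ y)

theorem linear_eq (n : ℕ) (γ : Aff n) (x : E n) : γ.linear x = x + linA n γ x := by
  simp [linA]

theorem comm_iff_ker (n : ℕ) (γ : Aff n) (u : E n) :
    τ n u * γ = γ * τ n u ↔ linA n γ u = 0 := by
  have key : ∀ x, γ (u + x) = γ.linear u + γ x := fun x => γ.map_vadd x u
  have e1 : ∀ x, (τ n u * γ) x = u + γ x := fun x => rfl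
  have e2 : ∀ x, (γ * τ n u) x = γ.linear u + γ x := fun x => key x
  constructor
  · intro h
    have h0 := e1 0
    rw [h, e2, linear_eq] at h0
    have := add_right_cancel h0
    simpa using this
  · intro h
    ext1 x
    rw [e1, e2, linear_eq, h, add_zero]

theorem anticomm (n s : ℕ) (Γ : Subgroup (Aff n)) (hWolf : ∀ γ ∈ Γ, WolfElt n s γ)
    (a b : Aff n) (ha : a ∈ Γ) (hb : b ∈ Γ) (x : E n) :
    linA n a (linA n b x) + linA n b (linA n a x) = 0 := by
  have hA : ∀ x, linA n a (linA n a x) = 0 := fun x => LinearMap.congr_fun (hWolf a ha).1 x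
  have hB : ∀ x, linA n b (linA n b x) = 0 := fun x => LinearMap.congr_fun (hWolf b hb).1 x
  have hC : ∀ x, linA n (a * b) (linA n (a * b) x) = 0 :=
    fun x => LinearMap.congr_fun (hWolf _ (Γ.mul_mem ha hb)).1 x
  have hm : ∀ x, linA n (a * b) x = linA n a x + linA n b x + linA n a (linA n b x) := by
    intro x
    have h1 : (a * b).linear x = a.linear (b.linear x) := rfl
    rw [linear_eq, linear_eq, linear_eq, map_add] at h1
    have h2 : x + linA n (a * b) x =
        x + (linA n a x + linA n b x + linA n a (linA n b x)) := by
      rw [h1]; abel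
    exact add_left_cancel h2
  have h1 := hC x
  simp only [hm, map_add, hA, hB, map_zero, add_zero, zero_add] at h1
  have h2 := congrArg (linA n a) h1
  simp only [map_add, hA, map_zero, add_zero, zero_add] at h2
  have h3 : linA n b (linA n a x) + linA n a (linA n b x)
      + linA n b (linA n a (linA n b x)) = 0 := by
    rw [← sub_eq_zero.mpr (h1.trans h2.symm)]; abel
  have h4 := congrArg (linA n b) h3
  simp only [map_add, hB, map_zero, add_zero, zero_add] at h4
  rw [h4, add_zero] at h3
  rw [add_comm]; exact h3

theorem comm_linear_iff (n : ℕ) (a b : Aff n) :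
    (a.linear.toLinearMap ∘ₗ b.linear.toLinearMap =
      b.linear.toLinearMap ∘ₗ a.linear.toLinearMap) ↔
    ∀ x, linA n a (linA n b x) = linA n b (linA n a x) := by
  rw [LinearMap.ext_iff]
  refine forall_congr' fun x => ?_
  change a.linear (b.linear x) = b.linear (a.linear x) ↔ _
  simp only [linear_eq, map_add]
  constructor
  · intro h
    have := sub_eq_zero.mpr h
    rw [← sub_eq_zero, ← this]; abel
  · intro h
    rw [h]; abel

/-- For a subgroup `Γ ⊆ Iso(ℝⁿ_s)` with the Wolf properties,
`Hol(Γ)` is abelian if and only if every translation `τ_u` by a vector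
`u ∈ U₀^⊥` commutes with every element of `Γ` (i.e. lies in the centraliser of `Γ`
in `Iso(ℝⁿ_s)`). -/
theorem holonomy_abelian_iff_perpU0_translations_central
    (n s : ℕ) (hn : 1 ≤ n) (hs : s ≤ n)
    (Γ : Subgroup (Aff n)) (hΓIso : (Γ : Set (Aff n)) ⊆ Iso n s)
    (hWolf : ∀ γ ∈ Γ, WolfElt n s γ) :
    HolAbelian n Γ ↔
      ∀ u ∈ perp n s (U0 n s Γ), ∀ γ ∈ Γ, τ n u * γ = γ * τ n u := by
  constructor
  · intro hab u hu γ hγ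
    have hz : ∀ a ∈ Γ, ∀ b ∈ Γ, ∀ x, linA n a (linA n b x) = 0 := by
      intro a ha b hb x
      have h1 := anticomm n s Γ hWolf a b ha hb x
      rw [← (comm_linear_iff n a b).1 (hab a ha b hb) x] at h1
      exact self_eq_neg.mp (eq_neg_of_add_eq_zero_left h1)
    have hB : ∀ a ∈ Γ, ∀ b ∈ Γ, ∀ x y, B n s (linA n b x) (linA n a y) = 0 := by
      intro a ha b hb x y
      have h1 : linA n b x ∈ (LinearMap.ker (linA n a) : Set (E n)) := hz a ha b hb x
      rw [(hWolf a ha).2.2.2.2.2] at h1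
      exact h1 _ ⟨y, rfl⟩
    have hB2 : ∀ b ∈ Γ, ∀ x, UGamma n Γ ≤ LinearMap.ker (B n s (linA n b x)) := by
      intro b hb x
      refine iSup₂_le fun a ha => ?_
      rintro _ ⟨y, rfl⟩
      exact hB a ha b hb x y
    rw [comm_iff_ker]
    have h2 : u ∈ (LinearMap.ker (linA n γ) : Set (E n)) := by
      rw [(hWolf γ hγ).2.2.2.2.2]
      rintro _ ⟨x, rfl⟩
      exact hu _ ⟨mem_UGamma n Γ γ hγ x, fun w hw => hB2 γ hγ x hw⟩
    exact h2
  · intro h a ha b hb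
    have hz : ∀ a ∈ Γ, ∀ b ∈ Γ, ∀ x, linA n a (linA n b x) = 0 := by
      intro a ha b hb x
      rw [← comm_iff_ker]
      refine h _ ?_ a ha
      intro w hw
      rw [B_symm']
      exact hw.2 _ (mem_UGamma n Γ b hb x)
    rw [comm_linear_iff]
    intro x
    rw [hz a ha b hb, hz b hb a ha]

end
end

section
/- Let Γ ⊆ Iso(ℝⁿ_s) be a subgroup having the Wolf properties such that for every u ∈ U₀^⊥ the translation τ_u : x ↦ x + u commutes with every element of Γ, and let D ⊆ ℝⁿ be an orbit of the centraliser C of Γ in Iso(ℝⁿ_s). Then D is translationally isotropic, i.e. T(D)^⊥ ⊆ T(D). -/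
noncomputable section

/-- Let `Γ ⊆ Iso(ℝⁿ_s)` be a subgroup with the Wolf properties such
that every translation by a vector of `U₀^⊥` commutes with every element of `Γ`, and
let `D` be an orbit of the centraliser `C` of `Γ` in `Iso(ℝⁿ_s)`. Then `D` is
translationally isotropic. -/
theorem centralising_perpU0_translations_implies_translationally_isotropic
    (n s : ℕ) (hn : 1 ≤ n) (hs : s ≤ n)
    (Γ : Subgroup (Aff n)) (hΓIso : (Γ : Set (Aff n)) ⊆ Iso n s)
    (hWolf : ∀ γ ∈ Γ, WolfElt n s γ)
    (hcomm : ∀ u ∈ perp n s (U0 n s Γ), ∀ γ ∈ Γ, τ n u * γ = γ * τ n u)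
    (D : Set (E n)) (p : E n)
    (hD : D = (fun g => g p) '' CentrIso n s Γ) :
    TranslationallyIsotropic n s D := by
  have hsub : ∀ u ∈ perp n s (U0 n s Γ), u ∈ TransSet n D := by
    intro u hu x hx
    rw [hD] at hx ⊢
    obtain ⟨g, ⟨hg, hgc⟩, rfl⟩ := hx
    refine ⟨τ n u * g, ⟨?_, ?_⟩, ?_⟩
    · intro x y
      exact hg x y
    · intro γ hγ
      rw [mul_assoc, hgc γ hγ, ← mul_assoc, hcomm u hu γ hγ, mul_assoc]
    · rfl
  intro x hx
  apply hsub
  intro w hw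
  apply hx
  apply hsub
  intro w' hw'
  exact hw.2 w' hw'.1

end
end
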